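/- Let n ≥ 3, m ≥ 1, let Q : ℝⁿ → ℝ be a 2m-homogeneous polynomial with Q(ξ) > 0 for all ξ ≠ 0, and for integers k ≥ 1, j ≥ 0 define J_{k,j}(y) := (1/|y|^{2k−1}) ∫_{{ξ ∈ S^{n−1} : ⟨y,ξ⟩ = 0}} D^{2j}(1/Q)(ξ)[(y/|y|)^{⊗ 2j}] dH^{n−2}(ξ) for y ≠ 0. Then for every y ∈ ℝⁿ\{0}: if j ≥ 1, Δ J_{k,j}(y) = c_Δ(n,m,j) · J_{k+1,j−1}(y) + c₀(n,m,k,j) · J_{k+1,j}(y) + J_{k+1,j+1}(y), and if j = 0, Δ J_{k,0}(y) = c₀(n,m,k,0) · J_{k+1,0}(y) + J_{k+1,1}(y), where c₀(n,m,k,j) = 2k(2k−1) + (n−1)(1−2k−2j) + 2(4j+1)(m+j) and c_Δ(n,m,j) = 4j(2j−1)(m+j−1)(2m+2j+1−n). -/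

import Mathlib

open MeasureTheory RealInnerProductSpace

noncomputable section

/-- ℝⁿ as a Euclidean space. -/
abbrev En (n : ℕ) : Type := EuclideanSpace ℝ (Fin n)

/-- The `i`-th standard basis vector of ℝⁿ. -/
def stdB (n : ℕ) (i : Fin n) : En n := EuclideanSpace.single i 1

/-- The symbol Q(ξ) = Σ_{i₁,…,i_{2m}} A_{i₁…i_{2m}} ξ_{i₁}⋯ξ_{i_{2m}}. -/
def symbolQ (n m : ℕ) (A : (Fin (2*m) → Fin n) → ℝ) (ξ : En n) : ℝ :=
  ∑ i : Fin (2*m) → Fin n, A i * ∏ j, ξ (i j)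

/-- The constant-coefficient operator
(Lψ)(x) = (−1)^m Σ A_{i₁…i_{2m}} ∂_{i₁}⋯∂_{i_{2m}} ψ(x). -/
def opL (n m : ℕ) (A : (Fin (2*m) → Fin n) → ℝ) (ψ : En n → ℝ) (x : En n) : ℝ :=
  (-1 : ℝ)^m * ∑ i : Fin (2*m) → Fin n,
    A i * iteratedFDeriv ℝ (2*m) ψ x (fun j => stdB n (i j))

/-- K is a fundamental solution of L: ∫ K(y) (Lψ)(y) dy = ψ(0) for all ψ ∈ C_c^∞. -/
def IsFundamentalSolution (n m : ℕ) (A : (Fin (2*m) → Fin n) → ℝ) (K : En n → ℝ) : Prop :=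
  ∀ ψ : En n → ℝ, ContDiff ℝ (⊤ : ℕ∞) ψ → HasCompactSupport ψ →
    ∫ y, K y * opL n m A ψ y = ψ 0

/-- K is homogeneous of degree a: K(σx) = |σ|^a K(x) for σ ≠ 0, x ≠ 0. -/
def HomogeneousDeg (n : ℕ) (a : ℝ) (K : En n → ℝ) : Prop :=
  ∀ σ : ℝ, σ ≠ 0 → ∀ x : En n, x ≠ 0 → K (σ • x) = |σ| ^ a * K x

/-- The Euclidean Laplacian Δf(x) = Σ_i ∂²f/∂x_i²(x). -/
def lap (n : ℕ) (f : En n → ℝ) (x : En n) : ℝ :=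
  ∑ i : Fin n, iteratedFDeriv ℝ 2 f x (fun _ => stdB n i)

/-- The point (x′, t) ∈ ℝ^{d} × ℝ = ℝ^{d+1}. -/
def snocVec (d : ℕ) (x' : En d) (t : ℝ) : En (d+1) :=
  (EuclideanSpace.equiv (Fin (d+1)) ℝ).symm (Fin.snoc (fun i => x' i) t)

/-- J_{k,j}(y) = |y|^{1−2k} ∫_{{|ξ|=1, ⟨y,ξ⟩=0}} D^{2j}(1/Q)(ξ)[(y/|y|)^{⊗2j}] dH^{n−2}. -/
def Jfun (n : ℕ) (Q : En n → ℝ) (k j : ℕ) (y : En n) : ℝ :=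
  (1/‖y‖^(2*k - 1)) *
    ∫ ξ in {ξ : En n | ‖ξ‖ = 1 ∧ ⟪y, ξ⟫ = 0},
      iteratedFDeriv ℝ (2*j) (fun z => 1 / Q z) ξ (fun _ => ‖y‖⁻¹ • y) ∂μH[(n : ℝ) - 2]


def Kset (n : ℕ) (y : En n) : Set (En n) := {ξ : En n | ‖ξ‖ = 1 ∧ ⟪y, ξ⟫ = 0}

lemma Kset_compact (n : ℕ) (y : En n) : IsCompact (Kset n y) := by
  have h : Kset n y = Metric.sphere (0 : En n) 1 ∩ {ξ | ⟪y, ξ⟫ = 0} := by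
    ext ξ; simp [Kset]
  rw [h]
  exact (isCompact_sphere _ _).inter_right (isClosed_eq (by fun_prop) continuous_const)

lemma Kset_ne {n : ℕ} {y x : En n} (h : x ∈ Kset n y) : x ≠ 0 := by
  rintro rfl; simp [Kset] at h

lemma Kset_finite (n : ℕ) (hn : 3 ≤ n) (y : En n) (hy : y ≠ 0) :
    μH[(n : ℝ) - 2] (Kset n y) < ⊤ := by
  obtain ⟨d, rfl⟩ : ∃ d, n = d + 2 := ⟨n - 2, by omega⟩
  have hcast : ((d + 2 : ℕ) : ℝ) - 2 = (Fintype.card (Fin d) : ℝ) := by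
    push_cast; simp
  rw [hcast]
  have f1 : Module.finrank ℝ (ℝ ∙ y)ᗮ = d + 1 := by
    have : Fact (Module.finrank ℝ (En (d+2)) = (d + 1) + 1) := ⟨by simp⟩
    exact Submodule.finrank_orthogonal_span_singleton hy
  have : Fact (Module.finrank ℝ (ℝ ∙ y)ᗮ = d + 1) := ⟨f1⟩
  have : Nontrivial (ℝ ∙ y)ᗮ := Module.nontrivial_of_finrank_pos (R := ℝ) (by omega)
  obtain ⟨v, hv⟩ : ∃ v : (ℝ ∙ y)ᗮ, ‖v‖ = 1 := exists_norm_eq _ zero_le_one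
  have hv0 : v ≠ 0 := by rintro rfl; simp at hv
  have f2 : Module.finrank ℝ (ℝ ∙ v)ᗮ = d := Submodule.finrank_orthogonal_span_singleton hv0
  let L := (Module.finBasisOfFinrankEq ℝ (ℝ ∙ v)ᗮ f2).equivFun.symm.toContinuousLinearEquiv
  let ι : (Fin d → ℝ) → En (d+2) := fun c => (((L c : (ℝ ∙ v)ᗮ) : (ℝ ∙ y)ᗮ) : En (d+2))
  have hι : ContDiff ℝ 1 ι := by
    have : ι = ((Submodule.subtypeL (ℝ ∙ y)ᗮ).comp ((Submodule.subtypeL (ℝ ∙ v)ᗮ).comp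
      (L : (Fin d → ℝ) →L[ℝ] (ℝ ∙ v)ᗮ))) := rfl
    rw [this]; exact ContinuousLinearMap.contDiff _
  let ψ : ℝ → (Fin d → ℝ) → En (d+2) := fun s c =>
    (1 + ‖ι c‖^2)⁻¹ • ((2 : ℝ) • ι c + (s * (1 - ‖ι c‖^2)) • (v : En (d+2)))
  have hψ : ∀ s, ContDiff ℝ 1 (ψ s) := by
    intro s
    have h1 : ContDiff ℝ 1 (fun c => ‖ι c‖^2) := hι.norm_sq ℝ
    refine ContDiff.smul (ContDiff.inv (contDiff_const.add h1) (fun c => by positivity)) ?_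
    exact (hι.const_smul (2:ℝ)).add
      ((contDiff_const.mul (contDiff_const.sub h1)).smul contDiff_const)
  let B : Set (Fin d → ℝ) := L.symm '' (Metric.closedBall 0 1)
  have hB : IsCompact B := (isCompact_closedBall _ _).image L.symm.continuous
  have hfin : ∀ s, μH[(Fintype.card (Fin d) : ℝ)] (ψ s '' B) < ⊤ := by
    intro s
    obtain ⟨C, hC⟩ := LocallyLipschitzOn.exists_lipschitzOnWith_of_compact hB
      ((hψ s).locallyLipschitz.locallyLipschitzOn)
    refine (hC.hausdorffMeasure_image_le (by positivity)).trans_lt ?_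
    rw [hausdorffMeasure_pi_real]
    exact ENNReal.mul_lt_top (ENNReal.rpow_lt_top_of_nonneg (by positivity) (by simp))
      hB.measure_lt_top
  refine lt_of_le_of_lt (measure_mono ?_) (measure_union_lt_top (hfin 1) (hfin (-1)))
  rintro ξ ⟨h1, h2⟩
  -- decompose
  let ξ' : (ℝ ∙ y)ᗮ := ⟨ξ, Submodule.mem_orthogonal_singleton_iff_inner_right.2 h2⟩
  set τ : ℝ := ⟪v, ξ'⟫ with hτ
  have hvv : ⟪v, v⟫ = 1 := by rw [real_inner_self_eq_norm_sq, hv]; norm_num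
  let g : (ℝ ∙ v)ᗮ := ⟨ξ' - τ • v, Submodule.mem_orthogonal_singleton_iff_inner_right.2 (by
    rw [inner_sub_right, inner_smul_right, hvv]; simp [hτ])⟩
  have hξ' : ‖ξ'‖ = 1 := h1
  have hg : ‖g‖^2 = 1 - τ^2 := by
    have : ‖g‖ = ‖ξ' - τ • v‖ := rfl
    rw [this, @norm_sub_sq_real, hξ', inner_smul_right, norm_smul, hv, real_inner_comm, ← hτ]
    rw [mul_one, Real.norm_eq_abs, sq_abs]; ring
  have key : ∀ s : ℝ, s^2 = 1 → 0 ≤ s * τ → ξ ∈ ψ s '' B := by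
    intro s hs hst
    have hpos : 0 < 1 + s * τ := by linarith
    have hL : ∀ q : (ℝ ∙ v)ᗮ, ι (L.symm q) = (q : (ℝ ∙ y)ᗮ) := by
      intro q; simp [ι]
    have hst2 : (s*τ)^2 = τ^2 := by rw [mul_pow, hs, one_mul]
    have hq : ‖(1 + s*τ)⁻¹ • g‖^2 = (1 - s*τ)/(1 + s*τ) := by
      rw [norm_smul, mul_pow, hg, ← hst2, norm_inv, Real.norm_eq_abs, abs_of_pos hpos]
      field_simp; ring
    refine ⟨L.symm ((1 + s*τ)⁻¹ • g), ⟨_, ?_, rfl⟩, ?_⟩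
    · rw [mem_closedBall_zero_iff]
      have : ‖(1 + s*τ)⁻¹ • g‖^2 ≤ 1 := by
        rw [hq, div_le_one hpos]; linarith
      nlinarith [norm_nonneg ((1 + s*τ)⁻¹ • g)]
    · have hn' : ‖ι (L.symm ((1 + s*τ)⁻¹ • g))‖^2 = (1 - s*τ)/(1 + s*τ) := by
        rw [hL, ← hq]; rfl
      simp only [ψ]
      rw [hn', hL]
      have hgx : (((g : (ℝ ∙ y)ᗮ)) : En (d+2)) = ξ - τ • (v : En (d+2)) := rfl
      have hc : ((((1 + s*τ)⁻¹ • g : (ℝ ∙ v)ᗮ) : (ℝ ∙ y)ᗮ) : En (d+2)) =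
        (1 + s*τ)⁻¹ • (ξ - τ • (v : En (d+2))) := rfl
      rw [hc]
      have e1 : (1 + (1 - s*τ)/(1 + s*τ))⁻¹ = (1 + s*τ)/2 := by field_simp; ring
      have e2 : s * (1 - (1 - s*τ)/(1 + s*τ)) = 2 * τ / (1 + s*τ) := by
        field_simp; linear_combination (2*τ) * hs
      rw [e1, e2]
      match_scalars
      · field_simp
      · field_simp; ring
  rcases le_total 0 τ with h | h
  · exact Or.inl (key 1 (by norm_num) (by linarith))
  · exact Or.inr (key (-1) (by norm_num) (by linarith))

open scoped ContDiff Topology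

def OO (n : ℕ) : Set (En n × En n) := {z | z.1 ≠ 0 ∧ z.2 ≠ 0}

lemma OO_open (n : ℕ) : IsOpen (OO n) :=
  (isOpen_ne_fun continuous_fst continuous_const).inter
    (isOpen_ne_fun continuous_snd continuous_const)

def Sm (n : ℕ) (a : En n × En n → ℝ) : Prop := ContDiffOn ℝ ∞ a (OO n)

lemma Sm.at {n : ℕ} {a : En n × En n → ℝ} (h : Sm n a) {z : En n × En n} (hz : z ∈ OO n) :
    ContDiffAt ℝ ∞ a z := ContDiffOn.contDiffAt h ((OO_open n).mem_nhds hz)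

def II (n : ℕ) (a : En n × En n → ℝ) (y : En n) : ℝ :=
  ∫ x in Kset n y, a (x, y) ∂μH[(n : ℝ) - 2]

def xi (n : ℕ) (w : En n) (z : En n × En n) : En n × En n :=
  (-(⟪z.1, w⟫ * (‖z.2‖^2)⁻¹) • z.2, w)

def TT (n : ℕ) (w : En n) (a : En n × En n → ℝ) (z : En n × En n) : ℝ :=
  fderiv ℝ a z (xi n w z)

lemma cont_int {E F : Type} [NormedAddCommGroup E] [NormedSpace ℝ E] [FiniteDimensional ℝ E]
    [NormedAddCommGroup F] [NormedSpace ℝ F] [FiniteDimensional ℝ F]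
    [MeasurableSpace E] [BorelSpace E] (μ : Measure E) (K : Set E) (hK : IsCompact K)
    (hμ : μ K < ⊤) (f : E → F) (hf : ContinuousOn f K) : Integrable f (μ.restrict K) := by
  obtain ⟨C, hC⟩ := hK.exists_bound_of_continuousOn hf
  have hfin : IsFiniteMeasure (μ.restrict K) := ⟨by simpa using hμ⟩
  exact Integrable.of_bound
    (hf.aestronglyMeasurable_of_isCompact hK hK.measurableSet) C
    (ae_restrict_of_forall_mem hK.measurableSet hC)

lemma param_deriv {E : Type} [NormedAddCommGroup E] [NormedSpace ℝ E] [FiniteDimensional ℝ E]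
    [MeasurableSpace E] [BorelSpace E] (μ : Measure E) (K : Set E) (hK : IsCompact K)
    (hμ : μ K < ⊤) (G : E × E → ℝ) (y0 : E) (hG : ∀ x ∈ K, ContDiffAt ℝ 1 G (y0, x)) :
    Integrable (fun x => (fderiv ℝ G (y0, x)).comp (ContinuousLinearMap.inl ℝ E E)) (μ.restrict K) ∧
    HasFDerivAt (fun y => ∫ x in K, G (y, x) ∂μ)
      (∫ x in K, (fderiv ℝ G (y0, x)).comp (ContinuousLinearMap.inl ℝ E E) ∂μ) y0 := by
  have : ProperSpace E := FiniteDimensional.proper ℝ E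
  set Ω : Set (E × E) := {z | ContDiffAt ℝ 1 G z} with hΩ
  have hΩo : IsOpen Ω := by
    rw [isOpen_iff_mem_nhds]
    intro z hz
    exact ContDiffAt.eventually hz (by simp)
  have hGΩ : ∀ z ∈ Ω, ContDiffAt ℝ 1 G z := fun z hz => hz
  have hcG : ContinuousOn G Ω := fun z hz => (hGΩ z hz).continuousAt.continuousWithinAt
  have hcG' : ContinuousOn (fun z => (fderiv ℝ G z).comp (ContinuousLinearMap.inl ℝ E E)) Ω := by
    intro z hz
    have h1 : ContinuousAt (fderiv ℝ G) z :=
      ((hGΩ z hz).fderiv_right (m := 0) (by simp)).continuousAt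
    exact (h1.clm_comp continuousAt_const).continuousWithinAt
  obtain ⟨U, V, hU, hV, hyU, hKV, hUV⟩ := generalized_tube_lemma (s := {y0}) isCompact_singleton
    (t := K) hK hΩo (by rintro ⟨a, b⟩ ⟨ha, hb⟩; obtain rfl : a = y0 := ha; exact hG b hb)
  obtain ⟨ε, hε, hεU⟩ := Metric.nhds_basis_closedBall.mem_iff.1 (hU.mem_nhds (hyU rfl))
  have hsub : Metric.closedBall y0 ε ×ˢ K ⊆ Ω := (Set.prod_mono hεU hKV).trans hUV
  have hsec : ∀ y ∈ Metric.closedBall y0 ε, Set.MapsTo (fun x => (y, x)) K Ω :=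
    fun y hy x hx => hsub ⟨hy, hx⟩
  obtain ⟨C, hC⟩ := ((isCompact_closedBall y0 ε).prod hK).exists_bound_of_continuousOn
    (hcG'.mono hsub)
  have hy0 : y0 ∈ Metric.closedBall y0 ε := Metric.mem_closedBall_self hε.le
  have hcont : ∀ y : E, ContinuousOn (fun x : E => (y, x)) K := fun y => by fun_prop
  have hfin : IsFiniteMeasure (μ.restrict K) := ⟨by simpa using hμ⟩
  refine ⟨?_, ?_⟩
  · exact cont_int μ K hK hμ _ (hcG'.comp (hcont y0) (hsec y0 hy0))
  refine hasFDerivAt_integral_of_dominated_of_fderiv_le (bound := fun _ => C)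
    (F := fun y x => G (y, x))
    (F' := fun y x => (fderiv ℝ G (y, x)).comp (ContinuousLinearMap.inl ℝ E E))
    (Metric.closedBall_mem_nhds y0 hε) ?_ ?_ ?_ ?_ (integrable_const _) ?_
  · filter_upwards [Metric.closedBall_mem_nhds y0 hε] with y hy
    exact (hcG.comp (hcont y) (hsec y hy)).aestronglyMeasurable_of_isCompact hK hK.measurableSet
  · exact cont_int μ K hK hμ _ (hcG.comp (hcont y0) (hsec y0 hy0))
  · exact (hcG'.comp (hcont y0) (hsec y0 hy0)).aestronglyMeasurable_of_isCompact hK hK.measurableSet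
  · exact ae_restrict_of_forall_mem hK.measurableSet fun x hx y hy => hC (y, x) ⟨hy, hx⟩
  · refine ae_restrict_of_forall_mem hK.measurableSet fun x hx y hy => ?_
    have h1 : HasFDerivAt G (fderiv ℝ G (y, x)) (y, x) :=
      ((hGΩ _ (hsub ⟨hy, hx⟩)).differentiableAt (by simp)).hasFDerivAt
    exact HasFDerivAt.comp y h1 (hasFDerivAt_prodMk_left y x)

def WW (n : ℕ) (y0 y : En n) : En n := ‖y‖ • y0 + ‖y0‖ • y

def VV (n : ℕ) (y0 y : En n) : En n := (2 * ‖y0‖ * (‖WW n y0 y‖^2)⁻¹) • WW n y0 y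

lemma change_var (n : ℕ) (a : En n × En n → ℝ) (y0 y : En n) (h0 : y0 ≠ 0) (hy : y ≠ 0)
    (hW : WW n y0 y ≠ 0) :
    II n a y = ∫ x in Kset n y0, a (x - ⟪y, x⟫ • VV n y0 y, y) ∂μH[(n : ℝ) - 2] := by
  set W := WW n y0 y with hWdef
  let ρ := (ℝ ∙ W)ᗮ.reflection
  have hρ : ∀ x, ρ x = x - (2 * (⟪W, x⟫ * (‖W‖^2)⁻¹)) • W := by
    intro x
    simp only [ρ]
    rw [Submodule.reflection_orthogonal_apply, Submodule.reflection_singleton_apply]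
    simp only [RCLike.ofReal_real_eq_id, id]
    module
  have hr : 0 < ‖y0‖ := norm_pos_iff.2 h0
  have hs : 0 < ‖y‖ := norm_pos_iff.2 hy
  have hWn : 0 < ‖W‖^2 := by have := norm_pos_iff.2 hW; positivity
  have hWy : ⟪W, y⟫ = ‖y‖ * (⟪y0, y⟫ + ‖y0‖ * ‖y‖) := by
    simp only [hWdef, WW, inner_add_left, inner_smul_left, real_inner_self_eq_norm_sq]
    simp; ring
  have hWW : ‖W‖^2 = 2 * ‖y‖ * ‖y0‖ * (⟪y0, y⟫ + ‖y0‖ * ‖y‖) := by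
    rw [hWdef, WW, @norm_add_sq_real, norm_smul, norm_smul, inner_smul_left, inner_smul_right]
    simp; ring
  have hρy : ρ y = (-(‖y‖ / ‖y0‖)) • y0 := by
    have e : 2 * (⟪W, y⟫ * (‖W‖^2)⁻¹) = ‖y0‖⁻¹ := by
      field_simp
      rw [hWy, hWW]; ring
    rw [hρ, e, hWdef, WW]
    match_scalars <;> field_simp
    ring
  have hpre : ρ ⁻¹' (Kset n y) = Kset n y0 := by
    ext x
    have h1 : ⟪y, ρ x⟫ = (-(‖y‖ / ‖y0‖)) * ⟪y0, x⟫ := by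
      have : ⟪y, ρ x⟫ = ⟪ρ y, ρ (ρ x)⟫ := (ρ.inner_map_map _ _).symm
      rw [this, Submodule.reflection_reflection, hρy, inner_smul_left]; simp
    have h2 : (-(‖y‖ / ‖y0‖)) ≠ 0 := by
      rw [neg_ne_zero]; positivity
    simp only [Kset, Set.mem_preimage, Set.mem_ofPred_eq, LinearIsometryEquiv.norm_map, h1]
    constructor
    · rintro ⟨p, q⟩; exact ⟨p, (mul_eq_zero.1 q).resolve_left h2⟩
    · rintro ⟨p, q⟩; exact ⟨p, by rw [q, mul_zero]⟩
  have hmp : MeasurePreserving ρ (μH[(n : ℝ) - 2]) (μH[(n : ℝ) - 2]) :=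
    ρ.toIsometryEquiv.measurePreserving_hausdorffMeasure _
  have hemb : MeasurableEmbedding ρ := ρ.toHomeomorph.measurableEmbedding
  rw [II, ← hmp.setIntegral_preimage_emb hemb, hpre]
  refine setIntegral_congr_fun (Kset_compact n y0).measurableSet ?_
  rintro x ⟨hx1, hx2⟩
  have : ρ x = x - ⟪y, x⟫ • VV n y0 y := by
    rw [hρ, VV, ← hWdef]
    have : ⟪W, x⟫ = ‖y0‖ * ⟪y, x⟫ := by
      simp [hWdef, WW, inner_add_left, inner_smul_left, hx2]
    rw [this]; module
  simp only [this]

lemma II_deriv (n : ℕ) (hn : 3 ≤ n) (a : En n × En n → ℝ) (ha : Sm n a) (y0 : En n) (h0 : y0 ≠ 0) :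
    ∃ L : En n →L[ℝ] ℝ, HasFDerivAt (II n a) L y0 ∧ ∀ w, L w = II n (TT n w a) y0 := by
  have hr : 0 < ‖y0‖ := norm_pos_iff.2 h0
  have hWc : ContDiffAt ℝ 1 (WW n y0) y0 := by
    unfold WW
    exact ((contDiffAt_norm ℝ h0).smul contDiffAt_const).add (contDiffAt_id.const_smul _)
  have hW0 : WW n y0 y0 = (2 * ‖y0‖) • y0 := by unfold WW; module
  have hW0' : WW n y0 y0 ≠ 0 := by
    rw [hW0]; exact smul_ne_zero (by positivity) h0
  have hVc : ContDiffAt ℝ 1 (VV n y0) y0 := by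
    unfold VV
    refine ContDiffAt.smul (contDiffAt_const.mul ((hWc.norm_sq ℝ).inv ?_)) hWc
    have := norm_pos_iff.2 hW0'
    positivity
  have hV0 : VV n y0 y0 = (‖y0‖^2)⁻¹ • y0 := by
    unfold VV
    rw [hW0, norm_smul, smul_smul]
    congr 1
    simp
    field_simp
  let Φ : En n × En n → En n × En n := fun p => (p.2 - ⟪p.1, p.2⟫ • VV n y0 p.1, p.1)
  have hΦ0 : ∀ x ∈ Kset n y0, Φ (y0, x) = (x, y0) := by
    rintro x ⟨h1, h2⟩; simp [Φ, h2]
  have hΦc : ∀ x, ContDiffAt ℝ 1 Φ (y0, x) := by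
    intro x
    have hV' : ContDiffAt ℝ 1 (fun p : En n × En n => VV n y0 p.1) (y0, x) :=
      ContDiffAt.comp (f := fun p : En n × En n => p.1) (y0, x) hVc contDiffAt_fst
    exact (contDiffAt_snd.sub ((contDiffAt_fst.inner ℝ contDiffAt_snd).smul hV')).prodMk
      contDiffAt_fst
  have hO : ∀ x ∈ Kset n y0, (x, y0) ∈ OO n := fun x hx => ⟨Kset_ne hx, h0⟩
  have hG : ∀ x ∈ Kset n y0, ContDiffAt ℝ 1 (a ∘ Φ) (y0, x) := by
    intro x hx
    refine ContDiffAt.comp (y0, x) ?_ (hΦc x)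
    rw [hΦ0 x hx]
    exact (ha.at (hO x hx)).of_le (by norm_cast)
  obtain ⟨hint, hder⟩ := param_deriv (μH[(n : ℝ) - 2]) (Kset n y0) (Kset_compact n y0)
    (Kset_finite n hn y0 h0) (a ∘ Φ) y0 hG
  refine ⟨_, hder.congr_of_eventuallyEq ?_, ?_⟩
  · have e1 : ∀ᶠ y in 𝓝 y0, WW n y0 y ≠ 0 := hWc.continuousAt.eventually_ne hW0'
    have e2 : ∀ᶠ y in 𝓝 y0, y ≠ 0 := eventually_ne_nhds h0
    filter_upwards [e1, e2] with y h1 h2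
    exact change_var n a y0 y h0 h2 h1
  · intro w
    rw [ContinuousLinearMap.integral_apply hint, II]
    refine setIntegral_congr_fun (Kset_compact n y0).measurableSet ?_
    intro x hx
    have hΦd : HasFDerivAt Φ (fderiv ℝ Φ (y0, x)) (y0, x) :=
      ((hΦc x).differentiableAt (by simp)).hasFDerivAt
    have had : DifferentiableAt ℝ a (Φ (y0, x)) := by
      rw [hΦ0 x hx]; exact (ha.at (hO x hx)).differentiableAt (by simp)
    simp only [ContinuousLinearMap.comp_apply, ContinuousLinearMap.inl_apply, TT]
    rw [fderiv_comp _ had ((hΦc x).differentiableAt (by simp)), hΦ0 x hx]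
    simp only [ContinuousLinearMap.comp_apply]
    congr 1
    have hV' : HasFDerivAt (fun p : En n × En n => VV n y0 p.1)
        ((fderiv ℝ (VV n y0) y0).comp (ContinuousLinearMap.fst ℝ (En n) (En n))) (y0, x) :=
      HasFDerivAt.comp (g := VV n y0) (f := fun p : En n × En n => p.1) (y0, x)
        ((hVc.differentiableAt (by simp)).hasFDerivAt) hasFDerivAt_fst
    have h := ((hasFDerivAt_snd (𝕜 := ℝ) (p := (y0, x))).sub
      (((hasFDerivAt_fst (𝕜 := ℝ) (p := (y0, x))).inner ℝ
        (hasFDerivAt_snd (𝕜 := ℝ) (p := (y0, x)))).smul hV')).prodMk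
          (hasFDerivAt_fst (𝕜 := ℝ) (p := (y0, x)))
    have h' : HasFDerivAt Φ _ (y0, x) := h
    rw [h'.fderiv]
    have hx2 : ⟪y0, x⟫ = 0 := hx.2
    simp [xi, hx2, hV0, fderivInnerCLM_apply, real_inner_comm, smul_smul]

abbrev D2 {n : ℕ} (a : En n × En n → ℝ) (z u v : En n × En n) : ℝ :=
  fderiv ℝ (fderiv ℝ a) z u v

lemma Sm.fd {n : ℕ} {a : En n × En n → ℝ} (h : Sm n a) :
    ContDiffOn ℝ ∞ (fderiv ℝ a) (OO n) :=
  ContDiffOn.fderiv_of_isOpen h (OO_open n) (by simp)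

lemma Sm.app {n : ℕ} {a : En n × En n → ℝ} (h : Sm n a) {X : En n × En n → En n × En n}
    (hX : ContDiffOn ℝ ∞ X (OO n)) : Sm n (fun z => fderiv ℝ a z (X z)) :=
  ContDiffOn.clm_apply h.fd hX

lemma Sm.diff {n : ℕ} {a : En n × En n → ℝ} (h : Sm n a) {z : En n × En n} (hz : z ∈ OO n) :
    DifferentiableAt ℝ a z := (h.at hz).differentiableAt (by simp)

lemma Sm.fdiff {n : ℕ} {a : En n × En n → ℝ} (h : Sm n a) {z : En n × En n} (hz : z ∈ OO n) :
    DifferentiableAt ℝ (fderiv ℝ a) z :=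
  (ContDiffOn.contDiffAt h.fd ((OO_open n).mem_nhds hz)).differentiableAt (by simp)

lemma D2_symm {n : ℕ} {a : En n × En n → ℝ} (h : Sm n a) {z : En n × En n} (hz : z ∈ OO n)
    (u v : En n × En n) : D2 a z u v = D2 a z v u :=
  ((h.at hz).isSymmSndFDerivAt (by
    rw [minSmoothness_of_isRCLikeNormedField]; exact WithTop.coe_le_coe.2 (le_top : (2 : ℕ∞) ≤ ⊤))) u v

lemma fderiv_app {n : ℕ} {a : En n × En n → ℝ} (h : Sm n a) {z : En n × En n} (hz : z ∈ OO n)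
    {X : En n × En n → En n × En n} (hX : DifferentiableAt ℝ X z) (u : En n × En n) :
    fderiv ℝ (fun z => fderiv ℝ a z (X z)) z u = D2 a z u (X z) + fderiv ℝ a z (fderiv ℝ X z u) := by
  rw [((h.fdiff hz).hasFDerivAt.clm_apply hX.hasFDerivAt).fderiv]
  simp [D2, add_comm]

lemma fderiv_app_const {n : ℕ} {a : En n × En n → ℝ} (h : Sm n a) {z : En n × En n} (hz : z ∈ OO n)
    (w u : En n × En n) :
    fderiv ℝ (fun z => fderiv ℝ a z w) z u = D2 a z u w := by
  rw [fderiv_app h hz (differentiableAt_const w)]; simp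

lemma xi_smooth (n : ℕ) (w : En n) : ContDiffOn ℝ ∞ (xi n w) (OO n) := by
  unfold xi
  have h1 : ContDiffOn ℝ ∞ (fun z : En n × En n => ⟪z.1, w⟫) (OO n) :=
    (contDiff_fst.inner ℝ contDiff_const).contDiffOn
  have h2 : ContDiffOn ℝ ∞ (fun z : En n × En n => (‖z.2‖^2)⁻¹) (OO n) := by
    refine ContDiffOn.inv (contDiff_snd.norm_sq ℝ).contDiffOn ?_
    rintro z ⟨_, h2⟩
    have := norm_pos_iff.2 h2
    positivity
  have h3 : ContDiffOn ℝ ∞ (fun z : En n × En n => z.2) (OO n) := contDiff_snd.contDiffOn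
  exact ContDiffOn.prodMk ((h1.mul h2).neg.smul h3) contDiffOn_const

lemma Sm.tt {n : ℕ} {a : En n × En n → ℝ} (h : Sm n a) (w : En n) : Sm n (TT n w a) :=
  h.app (xi_smooth n w)

lemma xi_fderiv (n : ℕ) (w : En n) (z : En n × En n) (hz : z ∈ OO n) (u : En n × En n) :
    fderiv ℝ (xi n w) z u =
      (-(⟪u.1, w⟫ * (‖z.2‖^2)⁻¹ - ⟪z.1, w⟫ * (2 * ⟪z.2, u.2⟫ * ((‖z.2‖^2)⁻¹)^2)) • z.2
        - (⟪z.1, w⟫ * (‖z.2‖^2)⁻¹) • u.2, 0) := by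
  have hr := norm_pos_iff.2 hz.2
  have h1 := (hasFDerivAt_fst (𝕜 := ℝ) (p := z)).inner ℝ (hasFDerivAt_const w z)
  have h2 := (hasDerivAt_inv (x := ‖z.2‖^2) (by positivity)).comp_hasFDerivAt z
    ((hasFDerivAt_snd (𝕜 := ℝ) (p := z)).norm_sq)
  have h3 := ((((h1.mul h2).neg).smul (hasFDerivAt_snd (𝕜 := ℝ) (p := z))).prodMk
    (hasFDerivAt_const w z))
  have h' : HasFDerivAt (xi n w) _ z := h3
  rw [h'.fderiv]
  simp [fderivInnerCLM_apply]
  module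

lemma TT2 {n : ℕ} {a : En n × En n → ℝ} (h : Sm n a) {z : En n × En n} (hz : z ∈ OO n)
    (v w : En n) : TT n v (TT n w a) z = D2 a z (xi n v z) (xi n w z) +
      fderiv ℝ a z (fderiv ℝ (xi n w) z (xi n v z)) :=
  fderiv_app h hz ((ContDiffOn.contDiffAt (xi_smooth n w)
    ((OO_open n).mem_nhds hz)).differentiableAt (by simp)) _

lemma II_fderiv (n : ℕ) (hn : 3 ≤ n) (a : En n × En n → ℝ) (ha : Sm n a) (y : En n) (hy : y ≠ 0)
    (w : En n) : fderiv ℝ (II n a) y w = II n (TT n w a) y := by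
  obtain ⟨L, h1, h2⟩ := II_deriv n hn a ha y hy
  rw [h1.fderiv, h2]

lemma II_diff (n : ℕ) (hn : 3 ≤ n) (a : En n × En n → ℝ) (ha : Sm n a) (y : En n) (hy : y ≠ 0) :
    DifferentiableAt ℝ (II n a) y := by
  obtain ⟨L, h1, h2⟩ := II_deriv n hn a ha y hy
  exact h1.differentiableAt

lemma inner_stdB (n : ℕ) (x : En n) (i : Fin n) : ⟪x, stdB n i⟫ = x i := by
  simp [stdB, EuclideanSpace.inner_single_right]

lemma sum_stdB (n : ℕ) (x : En n) : ∑ i, x i • stdB n i = x := by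
  ext j
  simp [stdB, Pi.single_apply]

lemma snd_fd (n : ℕ) (F : En n → ℝ) (g : En n → En n → ℝ) (y : En n) (hy : y ≠ 0)
    (hg : ∀ y', y' ≠ 0 → ∀ w, fderiv ℝ F y' w = g w y')
    (hgd : ∀ w, DifferentiableAt ℝ (g w) y) :
    DifferentiableAt ℝ (fderiv ℝ F) y ∧
      ∀ v w, fderiv ℝ (fderiv ℝ F) y v w = fderiv ℝ (g w) y v := by
  have hev : ∀ w, (fun y' => fderiv ℝ F y' w) =ᶠ[𝓝 y] g w := by
    intro w
    filter_upwards [eventually_ne_nhds hy] with y' h using hg y' h w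
  have hd : DifferentiableAt ℝ (fderiv ℝ F) y := by
    have e : fderiv ℝ F = fun y' => ∑ i, (fderiv ℝ F y' (stdB n i)) •
        (EuclideanSpace.proj i : En n →L[ℝ] ℝ) := by
      funext y'
      ext x
      conv_lhs => rw [← sum_stdB n x]
      simp [mul_comm]
    rw [e]
    refine DifferentiableAt.fun_sum fun i _ => ?_
    exact ((hgd (stdB n i)).congr_of_eventuallyEq (hev (stdB n i))).smul_const _
  refine ⟨hd, fun v w => ?_⟩
  rw [← (hev w).fderiv_eq, (hd.hasFDerivAt.clm_apply (hasFDerivAt_const w y)).fderiv]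
  simp

lemma rot (n : ℕ) (hn : 3 ≤ n) (a : En n × En n → ℝ) (ha : Sm n a) (y : En n) (hy : y ≠ 0)
    (hint : ∀ c, Sm n c → Integrable (fun x => c (x, y)) ((μH[(n : ℝ) - 2]).restrict (Kset n y)))
    (v w : En n) (hv : ⟪y, v⟫ = 0) (hw : ⟪y, w⟫ = 0) :
    II n (fun z => fderiv ℝ a z (⟪z.1, v⟫ • w - ⟪z.1, w⟫ • v, 0)) y = 0 := by
  obtain ⟨hd, hs⟩ := snd_fd n (II n a) (fun w => II n (TT n w a)) y hy
    (fun y' hy' w => II_fderiv n hn a ha y' hy' w) (fun w => II_diff n hn _ (ha.tt w) y hy)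
  have hsymm := second_derivative_symmetric_of_eventually (f := II n a) (f' := fderiv ℝ (II n a))
    (by filter_upwards [eventually_ne_nhds hy] with y' h using (II_diff n hn a ha y' h).hasFDerivAt)
    hd.hasFDerivAt v w
  rw [hs, hs, II_fderiv n hn _ (ha.tt w) y hy, II_fderiv n hn _ (ha.tt v) y hy] at hsymm
  have hr := norm_pos_iff.2 hy
  have hpt : ∀ x ∈ Kset n y, fderiv ℝ a (x, y) (⟪x, v⟫ • w - ⟪x, w⟫ • v, 0) =
      ‖y‖^2 * (TT n v (TT n w a) (x, y) - TT n w (TT n v a) (x, y)) := by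
    intro x hx
    have hz : (x, y) ∈ OO n := ⟨Kset_ne hx, hy⟩
    rw [TT2 ha hz, TT2 ha hz, xi_fderiv n _ _ hz, xi_fderiv n _ _ hz, D2_symm ha hz]
    rw [add_sub_add_left_eq_sub, ← map_sub, ← smul_eq_mul, ← map_smul]
    congr 1
    ext1
    · simp only [xi, inner_smul_left, hv, hw, Prod.smul_mk, Prod.mk_sub_mk]
      simp only [mul_zero, zero_mul, sub_self, neg_zero, zero_smul, zero_sub, smul_sub, smul_neg,
        smul_smul]
      have : ‖y‖^2 ≠ 0 := by positivity
      match_scalars <;> field_simp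
    · simp
  unfold II at hsymm ⊢
  rw [setIntegral_congr_fun (Kset_compact n y).measurableSet hpt, integral_const_mul,
    integral_sub (hint _ ((ha.tt w).tt v)) (hint _ ((ha.tt v).tt w)), hsymm, sub_self, mul_zero]

lemma Sm.int {n : ℕ} (hn : 3 ≤ n) {c : En n × En n → ℝ} (h : Sm n c) {y : En n} (hy : y ≠ 0) :
    Integrable (fun x => c (x, y)) ((μH[(n : ℝ) - 2]).restrict (Kset n y)) := by
  refine cont_int _ _ (Kset_compact n y) (Kset_finite n hn y hy) _ ?_
  refine (ContDiffOn.continuousOn h).comp (by fun_prop) ?_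
  intro x hx
  exact ⟨Kset_ne hx, hy⟩

def bb (n : ℕ) (f : En n → ℝ) : ℕ → En n × En n → ℝ
  | 0 => fun z => f z.1
  | (N+1) => fun z => fderiv ℝ (bb n f N) z (z.2, 0)

lemma y0_smooth (n : ℕ) : ContDiff ℝ ∞ (fun z : En n × En n => ((z.2, 0) : En n × En n)) :=
  contDiff_snd.prodMk contDiff_const

lemma bb_sm {n : ℕ} {f : En n → ℝ} (hf : ContDiffOn ℝ ∞ f {0}ᶜ) (N : ℕ) : Sm n (bb n f N) := by
  induction N with
  | zero =>
    refine ContDiffOn.comp (g := f) (f := fun z : En n × En n => z.1) hf contDiff_fst.contDiffOn ?_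
    intro z hz; exact hz.1
  | succ N ih => exact ih.app (y0_smooth n).contDiffOn

lemma bb_succ_fderiv {n : ℕ} {f : En n → ℝ} (hf : ContDiffOn ℝ ∞ f {0}ᶜ) (N : ℕ)
    {z : En n × En n} (hz : z ∈ OO n) (u : En n × En n) :
    fderiv ℝ (bb n f (N+1)) z u = D2 (bb n f N) z u (z.2, 0) + fderiv ℝ (bb n f N) z (u.2, 0) := by
  have h : HasFDerivAt (fun z : En n × En n => ((z.2, 0) : En n × En n)) _ z :=
    (hasFDerivAt_snd (𝕜 := ℝ) (p := z)).prodMk (hasFDerivAt_const (0 : En n) z)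
  have := fderiv_app (bb_sm hf N) hz h.differentiableAt u
  rw [h.fderiv] at this
  simpa [bb] using this

lemma bb_zero_y {n : ℕ} {f : En n → ℝ} (hf : ContDiffOn ℝ ∞ f {0}ᶜ)
    {z : En n × En n} (hz : z ∈ OO n) (u : En n × En n) :
    fderiv ℝ (bb n f 0) z u = fderiv ℝ f z.1 u.1 := by
  have hd : DifferentiableAt ℝ f z.1 :=
    (hf.contDiffAt (isOpen_compl_singleton.mem_nhds hz.1)).differentiableAt (by simp)
  have h : HasFDerivAt (bb n f 0) _ z :=
    HasFDerivAt.comp (g := f) (f := fun z : En n × En n => z.1) z hd.hasFDerivAt hasFDerivAt_fst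
  rw [h.fderiv]; simp

lemma D2_congr {n : ℕ} {a c : En n × En n → ℝ} (ha : Sm n a) (hc : Sm n c) (s : ℝ)
    (v w : En n × En n)
    (h : ∀ z ∈ OO n, fderiv ℝ a z v = s * fderiv ℝ c z w)
    {z : En n × En n} (hz : z ∈ OO n) (u : En n × En n) : D2 a z u v = s * D2 c z u w := by
  rw [← fderiv_app_const ha hz, ← fderiv_app_const hc hz]
  have : (fun z => fderiv ℝ a z v) =ᶠ[𝓝 z] (fun z => s * fderiv ℝ c z w) := by
    filter_upwards [(OO_open n).mem_nhds hz] with z' hz' using h z' hz'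
  rw [this.fderiv_eq, fderiv_const_mul]
  · simp
  · exact (hc.app contDiffOn_const).diff hz

lemma bb_dy {n : ℕ} {f : En n → ℝ} (hf : ContDiffOn ℝ ∞ f {0}ᶜ) (N : ℕ) :
    ∀ z ∈ OO n, ∀ h : En n,
      fderiv ℝ (bb n f (N+1)) z (0, h) = ((N : ℝ) + 1) * fderiv ℝ (bb n f N) z (h, 0) := by
  induction N with
  | zero =>
    intro z hz h
    rw [bb_succ_fderiv hf 0 hz, D2_symm (bb_sm hf 0) hz,
      D2_congr (bb_sm hf 0) (bb_sm hf 0) 0 (0, h) 0 (by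
        intro z hz; rw [bb_zero_y hf hz]; simp) hz]
    simp
  | succ N ih =>
    intro z hz h
    rw [bb_succ_fderiv hf (N+1) hz, D2_symm (bb_sm hf (N+1)) hz,
      D2_congr (bb_sm hf (N+1)) (bb_sm hf N) (N+1) (0, h) (h, 0) (fun z hz => ih z hz h) hz]
    rw [D2_symm (bb_sm hf N) hz]
    have := bb_succ_fderiv hf N hz (h, 0)
    simp only [Prod.mk_zero_zero, map_zero, add_zero] at this
    rw [← this]; push_cast; ring

lemma bb_D2x {n : ℕ} {f : En n → ℝ} (hf : ContDiffOn ℝ ∞ f {0}ᶜ) (N : ℕ)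
    {z : En n × En n} (hz : z ∈ OO n) (h : En n) :
    D2 (bb n f N) z (z.2, 0) (h, 0) = fderiv ℝ (bb n f (N+1)) z (h, 0) := by
  have := bb_succ_fderiv hf N hz (h, 0)
  simp only [Prod.mk_zero_zero, map_zero, add_zero] at this
  rw [D2_symm (bb_sm hf N) hz, this]

lemma bb_D2yy {n : ℕ} {f : En n → ℝ} (hf : ContDiffOn ℝ ∞ f {0}ᶜ) (N : ℕ)
    {z : En n × En n} (hz : z ∈ OO n) :
    D2 (bb n f N) z (z.2, 0) (z.2, 0) = bb n f (N+2) z := by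
  rw [bb_D2x hf N hz]; rfl

lemma bb_D2y {n : ℕ} {f : En n → ℝ} (hf : ContDiffOn ℝ ∞ f {0}ᶜ) (N : ℕ)
    {z : En n × En n} (hz : z ∈ OO n) (u : En n × En n) (h : En n) :
    D2 (bb n f (N+1)) z u (0, h) = ((N : ℝ) + 1) * D2 (bb n f N) z u (h, 0) :=
  D2_congr (bb_sm hf (N+1)) (bb_sm hf N) _ (0, h) (h, 0) (fun z hz => bb_dy hf N z hz h) hz u

lemma bb_D2y_zero {n : ℕ} {f : En n → ℝ} (hf : ContDiffOn ℝ ∞ f {0}ᶜ)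
    {z : En n × En n} (hz : z ∈ OO n) (u : En n × En n) (h : En n) :
    D2 (bb n f 0) z u (0, h) = 0 := by
  rw [D2_congr (bb_sm hf 0) (bb_sm hf 0) 0 (0, h) 0 (by
        intro z hz; rw [bb_zero_y hf hz]; simp) hz]
  simp

lemma bb_euler {n : ℕ} {f : En n → ℝ} (hf : ContDiffOn ℝ ∞ f {0}ᶜ) (d : ℝ)
    (he : ∀ x, x ≠ 0 → fderiv ℝ f x x = d * f x) (N : ℕ) :
    ∀ z ∈ OO n, fderiv ℝ (bb n f N) z (z.1, 0) = (d - N) * bb n f N z := by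
  induction N with
  | zero => intro z hz; rw [bb_zero_y hf hz, he _ hz.1]; simp [bb]
  | succ N ih =>
    intro z hz
    rw [← bb_D2x hf N hz]
    have h : HasFDerivAt (fun z : En n × En n => ((z.1, 0) : En n × En n)) _ z :=
      (hasFDerivAt_fst (𝕜 := ℝ) (p := z)).prodMk (hasFDerivAt_const (0 : En n) z)
    have h1 := fderiv_app (bb_sm hf N) hz h.differentiableAt (z.2, 0)
    rw [h.fderiv] at h1
    have h2 : (fun z => fderiv ℝ (bb n f N) z (z.1, 0)) =ᶠ[𝓝 z] (fun z => (d - N) * bb n f N z) := by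
      filter_upwards [(OO_open n).mem_nhds hz] with z' hz' using ih z' hz'
    rw [h2.fderiv_eq, fderiv_const_mul ((bb_sm hf N).diff hz)] at h1
    have h3 : fderiv ℝ (bb n f N) z (z.2, 0) = bb n f (N+1) z := rfl
    simp only [ContinuousLinearMap.prod_apply, ContinuousLinearMap.coe_fst',
      zero_apply, h3, smul_apply, smul_eq_mul] at h1
    push_cast
    linarith

lemma bb_yeuler {n : ℕ} {f : En n → ℝ} (hf : ContDiffOn ℝ ∞ f {0}ᶜ) (N : ℕ)
    {z : En n × En n} (hz : z ∈ OO n) :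
    fderiv ℝ (bb n f N) z (0, z.2) = N * bb n f N z := by
  cases N with
  | zero => rw [bb_zero_y hf hz]; simp
  | succ N => rw [bb_dy hf N z hz]; push_cast; rfl

lemma bb_iter {n : ℕ} {f : En n → ℝ} (hf : ContDiffOn ℝ ∞ f {0}ᶜ) (N : ℕ) :
    ∀ x y : En n, x ≠ 0 → y ≠ 0 → iteratedFDeriv ℝ N f x (fun _ => y) = bb n f N (x, y) := by
  induction N with
  | zero => intro x y _ _; simp [bb]
  | succ N ih =>
    intro x y hx hy
    have hfx : ContDiffAt ℝ ∞ f x := hf.contDiffAt (isOpen_compl_singleton.mem_nhds hx)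
    have hd : DifferentiableAt ℝ (iteratedFDeriv ℝ N f) x :=
      hfx.differentiableAt_iteratedFDeriv (by exact_mod_cast ENat.natCast_lt_top N)
    rw [iteratedFDeriv_succ_apply_left]
    have h1 : HasFDerivAt (fun x' => iteratedFDeriv ℝ N f x' (fun _ => y))
      ((ContinuousMultilinearMap.apply ℝ (fun _ : Fin N => En n) ℝ (fun _ => y)).comp
        (fderiv ℝ (iteratedFDeriv ℝ N f) x)) x :=
      HasFDerivAt.comp (g := ContinuousMultilinearMap.apply ℝ (fun _ : Fin N => En n) ℝ (fun _ => y))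
        x (ContinuousLinearMap.hasFDerivAt _) hd.hasFDerivAt
    have h2 : (fun x' => iteratedFDeriv ℝ N f x' (fun _ => y)) =ᶠ[𝓝 x]
        (fun x' => bb n f N (x', y)) := by
      filter_upwards [eventually_ne_nhds hx] with x' hx' using ih x' y hx' hy
    have h3 : HasFDerivAt (fun x' => bb n f N (x', y)) _ x :=
      HasFDerivAt.comp x ((bb_sm hf N).diff (z := (x, y)) ⟨hx, hy⟩).hasFDerivAt
        (hasFDerivAt_prodMk_left x y)
    have h4 := h1.unique (h3.congr_of_eventuallyEq h2)
    have h5 := congrArg (fun L => L y) h4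
    simp only [bb]
    simp at h5
    exact h5

def pp (n : ℕ) (y : En n) (i : Fin n) : En n := stdB n i - (y i * (‖y‖^2)⁻¹) • y

lemma sum_coord (n : ℕ) (x y : En n) : ∑ i, x i * y i = ⟪x, y⟫ := by
  simp [PiLp.inner_apply, mul_comm]

lemma pp_perp (n : ℕ) (y : En n) (hy : y ≠ 0) (i : Fin n) : ⟪y, pp n y i⟫ = 0 := by
  have := norm_pos_iff.2 hy
  rw [pp, inner_sub_right, inner_stdB, inner_smul_right, real_inner_self_eq_norm_sq]
  field_simp; ring

lemma inner_pp (n : ℕ) (x y : En n) (h : ⟪y, x⟫ = 0) (i : Fin n) : ⟪x, pp n y i⟫ = x i := by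
  rw [pp, inner_sub_right, inner_stdB, inner_smul_right, real_inner_comm, h]; simp

lemma pp_self (n : ℕ) (y : En n) (hy : y ≠ 0) (i : Fin n) :
    ⟪pp n y i, pp n y i⟫ = 1 - y i * y i * (‖y‖^2)⁻¹ := by
  rw [inner_pp n _ y (pp_perp n y hy i)]
  simp [pp, stdB]; ring

lemma sum_pp (n : ℕ) (x y : En n) (h : ⟪y, x⟫ = 0) : ∑ i, x i • pp n y i = x := by
  simp only [pp, smul_sub, Finset.sum_sub_distrib, sum_stdB, smul_smul, ← Finset.sum_smul,
    ← mul_assoc, ← Finset.sum_mul]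
  rw [sum_coord, real_inner_comm, h]; simp

lemma sum_pp_self (n : ℕ) (y : En n) (hy : y ≠ 0) :
    ∑ i, ⟪pp n y i, pp n y i⟫ = (n : ℝ) - 1 := by
  have := norm_pos_iff.2 hy
  simp only [pp_self n y hy, Finset.sum_sub_distrib, ← Finset.sum_mul]
  rw [sum_coord, real_inner_self_eq_norm_sq]
  simp
  field_simp

lemma alg1 (n : ℕ) (l : En n →ₗ[ℝ] ℝ) (B : En n →ₗ[ℝ] En n →ₗ[ℝ] ℝ) (x y : En n) (hy : y ≠ 0)
    (hx : ⟪y, x⟫ = 0) (hx1 : ‖x‖ = 1) :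
    ∑ i, ∑ j, (⟪⟪x, pp n y i⟫ • pp n y j - ⟪x, pp n y j⟫ • pp n y i, pp n y i⟫ * l (pp n y j)
      + ⟪x, pp n y i⟫ * B (⟪x, pp n y i⟫ • pp n y j - ⟪x, pp n y j⟫ • pp n y i) (pp n y j))
    = (2 - (n : ℝ)) * l x + ∑ i, B (stdB n i) (stdB n i) - (‖y‖^2)⁻¹ * B y y - B x x := by
  have hr := norm_pos_iff.2 hy
  simp only [inner_pp n x y hx]
  have hsx : ∑ i, x i * x i = 1 := by rw [sum_coord, real_inner_self_eq_norm_sq, hx1]; norm_num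
  have e1 : ∑ i, ∑ j, ⟪x i • pp n y j - x j • pp n y i, pp n y i⟫ * l (pp n y j)
      = (2 - (n : ℝ)) * l x := by
    rw [Finset.sum_comm]
    have : ∀ j, ∑ i, ⟪x i • pp n y j - x j • pp n y i, pp n y i⟫ * l (pp n y j)
        = (2 - (n : ℝ)) * l (x j • pp n y j) := by
      intro j
      rw [← Finset.sum_mul]
      have : ∑ i, ⟪x i • pp n y j - x j • pp n y i, pp n y i⟫ = (2 - (n : ℝ)) * x j := by
        simp only [inner_sub_left, inner_smul_left, Finset.sum_sub_distrib, RCLike.conj_to_real]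
        rw [← Finset.mul_sum, sum_pp_self n y hy]
        have : ∑ i, x i * ⟪pp n y j, pp n y i⟫ = ⟪pp n y j, ∑ i, x i • pp n y i⟫ := by
          rw [inner_sum]; simp only [inner_smul_right]
        rw [this, sum_pp n x y hx, real_inner_comm, inner_pp n x y hx]; ring
      rw [this, map_smul, smul_eq_mul]; ring
    simp only [this]
    rw [← Finset.mul_sum, ← map_sum, sum_pp n x y hx]
  have e2 : ∑ i, ∑ j, x i * B (x i • pp n y j - x j • pp n y i) (pp n y j)
      = ∑ j, B (pp n y j) (pp n y j) - B x x := by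
    have h1 : ∀ i j, x i * B (x i • pp n y j - x j • pp n y i) (pp n y j)
        = x i * x i * B (pp n y j) (pp n y j) - B (x i • pp n y i) (x j • pp n y j) := by
      intro i j
      simp only [map_sub, map_smul, LinearMap.sub_apply, LinearMap.smul_apply, smul_eq_mul]; ring
    simp only [h1, Finset.sum_sub_distrib]
    congr 1
    · rw [Finset.sum_comm]
      simp only [← Finset.sum_mul, hsx, one_mul]
    · simp only [← map_sum, sum_pp n x y hx]
      rw [← LinearMap.sum_apply, ← map_sum, sum_pp n x y hx]
  have e3 : ∑ j, B (pp n y j) (pp n y j) = ∑ i, B (stdB n i) (stdB n i) - (‖y‖^2)⁻¹ * B y y := by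
    have h1 : ∀ j, B (pp n y j) (pp n y j) = B (stdB n j) (stdB n j)
        - (‖y‖^2)⁻¹ * B (y j • stdB n j) y - (‖y‖^2)⁻¹ * B y (y j • stdB n j)
        + y j * y j * ((‖y‖^2)⁻¹ * (‖y‖^2)⁻¹ * B y y) := by
      intro j
      simp only [pp, map_sub, map_smul, LinearMap.sub_apply, LinearMap.smul_apply, smul_eq_mul]
      ring
    simp only [h1, Finset.sum_add_distrib, Finset.sum_sub_distrib, ← Finset.mul_sum, ← map_sum,
      ← Finset.sum_mul]
    rw [← LinearMap.sum_apply, ← map_sum, sum_stdB, sum_coord, real_inner_self_eq_norm_sq]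
    field_simp; ring
  simp only [Finset.sum_add_distrib]
  rw [e1, e2, e3]; ring

lemma alg2 (n : ℕ) (a : En n × En n → ℝ) (x y : En n) (hz : (x, y) ∈ OO n) (ha : Sm n a)
    (hx : ⟪y, x⟫ = 0) (hx1 : ‖x‖ = 1) :
    ∑ i, TT n (stdB n i) (TT n (stdB n i) a) (x, y) =
      ∑ i, D2 a (x, y) (0, stdB n i) (0, stdB n i)
      - 2 * (‖y‖^2)⁻¹ * D2 a (x, y) (y, 0) (0, x)
      + ((‖y‖^2)⁻¹)^2 * D2 a (x, y) (y, 0) (y, 0)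
      - (‖y‖^2)⁻¹ * fderiv ℝ a (x, y) (x, 0) := by
  set s := (‖y‖^2)⁻¹ with hs
  have hsx : ∑ i, x i * x i = 1 := by rw [sum_coord, real_inner_self_eq_norm_sq, hx1]; norm_num
  have hxy : ∑ i, x i * y i = 0 := by rw [sum_coord, real_inner_comm, hx]
  have hxi : ∀ i, xi n (stdB n i) (x, y) = (-(x i * s)) • ((y, 0) : En n × En n) + (0, stdB n i) := by
    intro i; simp [xi, inner_stdB, hs]
  have hfx : ∀ i, fderiv ℝ (xi n (stdB n i)) (x, y) (xi n (stdB n i) (x, y)) =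
      (x i * y i) • ((3 * s^2) • ((y, 0) : En n × En n)) - s • (x i • ((stdB n i, 0) : En n × En n)) := by
    intro i
    rw [xi_fderiv n _ _ hz]
    simp [xi, inner_stdB, inner_smul_left, ← hs]
    module
  have hsum1 : ∑ i, x i • ((stdB n i, 0) : En n × En n) = (x, 0) := by
    ext1 <;> simp [Prod.fst_sum, Prod.snd_sum, sum_stdB]
  have hsum2 : ∑ i, x i • ((0, stdB n i) : En n × En n) = (0, x) := by
    ext1 <;> simp [Prod.fst_sum, Prod.snd_sum, sum_stdB]
  have h1 : ∀ i, TT n (stdB n i) (TT n (stdB n i) a) (x, y) =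
      D2 a (x, y) (0, stdB n i) (0, stdB n i)
      - 2 * s * D2 a (x, y) (y, 0) (x i • (0, stdB n i))
      + (x i * x i) * (s^2 * D2 a (x, y) (y, 0) (y, 0))
      + ((x i * y i) * (3 * s^2 * fderiv ℝ a (x, y) (y, 0))
      - s * fderiv ℝ a (x, y) (x i • (stdB n i, 0))) := by
    intro i
    rw [TT2 ha hz, hfx, hxi]
    have hsym := D2_symm ha hz (0, stdB n i) (y, 0)
    simp only [D2] at hsym ⊢
    simp only [map_add, map_sub, map_smul, add_apply, smul_apply, smul_eq_mul, hsym]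
    ring
  simp only [h1, Finset.sum_add_distrib, Finset.sum_sub_distrib, ← Finset.mul_sum, ← map_sum,
      ← Finset.sum_mul, hsum1, hsum2, hsx, hxy]
  ring

lemma Sm.d2 {n : ℕ} {a : En n × En n → ℝ} (h : Sm n a) {X Y : En n × En n → En n × En n}
    (hX : ContDiffOn ℝ ∞ X (OO n)) (hY : ContDiffOn ℝ ∞ Y (OO n)) :
    Sm n (fun z => D2 a z (X z) (Y z)) := by
  have h2 : ContDiffOn ℝ ∞ (fderiv ℝ (fderiv ℝ a)) (OO n) :=
    ContDiffOn.fderiv_of_isOpen h.fd (OO_open n) (by simp)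
  exact ContDiffOn.clm_apply (ContDiffOn.clm_apply h2 hX) hY

lemma euler2 {n : ℕ} {c : En n × En n → ℝ} (hc : Sm n c) (d : ℝ)
    (he : ∀ z ∈ OO n, fderiv ℝ c z (z.1, 0) = d * c z) {z : En n × En n} (hz : z ∈ OO n) :
    D2 c z (z.1, 0) (z.1, 0) = d * (d - 1) * c z := by
  have h : HasFDerivAt (fun z : En n × En n => ((z.1, 0) : En n × En n)) _ z :=
    (hasFDerivAt_fst (𝕜 := ℝ) (p := z)).prodMk (hasFDerivAt_const (0 : En n) z)
  have h1 := fderiv_app hc hz h.differentiableAt (z.1, 0)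
  rw [h.fderiv] at h1
  have h2 : (fun z => fderiv ℝ c z (z.1, 0)) =ᶠ[𝓝 z] (fun z => d * c z) := by
    filter_upwards [(OO_open n).mem_nhds hz] with z' hz' using he z' hz'
  rw [h2.fderiv_eq, fderiv_const_mul (hc.diff hz)] at h1
  simp only [ContinuousLinearMap.prod_apply, ContinuousLinearMap.coe_fst',
      zero_apply, smul_apply, smul_eq_mul, he z hz] at h1
  linarith

lemma partC (n : ℕ) (hn : 3 ≤ n) (c : En n × En n → ℝ) (hc : Sm n c) (d : ℝ)
    (he : ∀ z ∈ OO n, fderiv ℝ c z (z.1, 0) = d * c z) (y : En n) (hy : y ≠ 0) :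
    II n (fun z => ∑ i, D2 c z (stdB n i, 0) (stdB n i, 0)) y =
      d * (d + n - 3) * II n c y + (‖y‖^2)⁻¹ * II n (fun z => D2 c z (z.2, 0) (z.2, 0)) y := by
  have hint : ∀ c, Sm n c → Integrable (fun x => c (x, y)) ((μH[(n : ℝ) - 2]).restrict (Kset n y)) :=
    fun c h => h.int hn hy
  let a : Fin n → Fin n → En n × En n → ℝ :=
    fun i j z => ⟪z.1, pp n y i⟫ * fderiv ℝ c z (pp n y j, 0)
  let V : Fin n → Fin n → En n × En n → En n × En n :=
    fun i j z => (⟪z.1, pp n y i⟫ • pp n y j - ⟪z.1, pp n y j⟫ • pp n y i, 0)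
  have hin : ∀ v : En n, ContDiff ℝ ∞ (fun z : En n × En n => ⟪z.1, v⟫) := fun v =>
    contDiff_fst.inner ℝ contDiff_const
  have ha : ∀ i j, Sm n (a i j) := fun i j =>
    ContDiffOn.mul (hin _).contDiffOn (hc.app contDiffOn_const)
  have hV : ∀ i j, ContDiffOn ℝ ∞ (V i j) (OO n) := fun i j =>
    ContDiff.contDiffOn ((((hin _).smul contDiff_const).sub ((hin _).smul contDiff_const)).prodMk
      contDiff_const)
  have h0 : ∀ i j, ∫ x in Kset n y, fderiv ℝ (a i j) (x, y) (V i j (x, y)) ∂μH[(n : ℝ) - 2] = 0 :=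
    fun i j => rot n hn (a i j) (ha i j) y hy hint _ _ (pp_perp n y hy i) (pp_perp n y hy j)
  have hS : ∫ x in Kset n y, ∑ i, ∑ j, fderiv ℝ (a i j) (x, y) (V i j (x, y)) ∂μH[(n : ℝ) - 2] = 0 := by
    rw [integral_finsetSum _ (fun i _ => integrable_finsetSum _ fun j _ =>
      hint _ ((ha i j).app (hV i j)))]
    refine Finset.sum_eq_zero fun i _ => ?_
    rw [integral_finsetSum _ (fun j _ => hint _ ((ha i j).app (hV i j)))]
    exact Finset.sum_eq_zero fun j _ => h0 i j
  have hpt : ∀ x ∈ Kset n y, ∑ i, ∑ j, fderiv ℝ (a i j) (x, y) (V i j (x, y)) =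
      ∑ i, D2 c (x, y) (stdB n i, 0) (stdB n i, 0) - ((d * (d + n - 3)) * c (x, y)
        + (‖y‖^2)⁻¹ * D2 c (x, y) (y, 0) (y, 0)) := by
    intro x hx
    have hz : (x, y) ∈ OO n := ⟨Kset_ne hx, hy⟩
    let l : En n →ₗ[ℝ] ℝ := (fderiv ℝ c (x, y)).toLinearMap.comp (LinearMap.inl ℝ (En n) (En n))
    let B : En n →ₗ[ℝ] En n →ₗ[ℝ] ℝ := LinearMap.mk₂ ℝ (fun u v => D2 c (x, y) (u, 0) (v, 0))
      (by intro u u' v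
          have : ((u + u', 0) : En n × En n) = (u, 0) + (u', 0) := by simp
          simp only [D2, this, map_add, add_apply])
      (by intro r u v
          have : ((r • u, 0) : En n × En n) = r • (u, 0) := by simp
          simp only [D2, this, map_smul, smul_apply])
      (by intro u u' v
          have : ((u' + v, 0) : En n × En n) = (u', 0) + (v, 0) := by simp
          simp only [D2, this, map_add, add_apply])
      (by intro r u v
          have : ((r • v, 0) : En n × En n) = r • (v, 0) := by simp
          simp only [D2, this, map_smul])
    have hB : ∀ u v, B u v = D2 c (x, y) (u, 0) (v, 0) := fun u v => rfl
    have hl : ∀ u, l u = fderiv ℝ c (x, y) (u, 0) := fun u => by simp [l]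
    have e := alg1 n l B x y hy hx.2 hx.1
    simp only [hB, hl] at e
    have h1 := he _ hz
    have h2 := euler2 hc d he hz
    simp only at h1 h2
    rw [h1, h2] at e
    have e' : ∀ i j, fderiv ℝ (a i j) (x, y) (V i j (x, y)) =
      ⟪⟪x, pp n y i⟫ • pp n y j - ⟪x, pp n y j⟫ • pp n y i, pp n y i⟫ * fderiv ℝ c (x, y) (pp n y j, 0)
      + ⟪x, pp n y i⟫ * D2 c (x, y) (⟪x, pp n y i⟫ • pp n y j - ⟪x, pp n y j⟫ • pp n y i, 0) (pp n y j, 0) := by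
      intro i j
      have g1 : HasFDerivAt (fun z : En n × En n => ⟪z.1, pp n y i⟫) _ (x, y) :=
        (hasFDerivAt_fst (𝕜 := ℝ) (p := (x, y))).inner ℝ (hasFDerivAt_const (pp n y i) (x, y))
      have g2 := ((hc.app (X := fun _ => (pp n y j, 0)) contDiffOn_const).diff hz).hasFDerivAt
      have g3 : HasFDerivAt (a i j) _ (x, y) := g1.mul g2
      rw [g3.fderiv]
      simp only [add_apply, smul_apply, smul_eq_mul,
        fderiv_app_const hc hz, V]
      simp [fderivInnerCLM_apply]
      ring
    simp only [e', e]
    ring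
  rw [setIntegral_congr_fun (Kset_compact n y).measurableSet hpt] at hS
  have i1 : Integrable (fun x => ∑ i, D2 c (x, y) (stdB n i, 0) (stdB n i, 0))
      ((μH[(n : ℝ) - 2]).restrict (Kset n y)) :=
    integrable_finsetSum _ fun i _ => hint _ (hc.d2 contDiffOn_const contDiffOn_const)
  have i2 := (hint _ hc).const_mul (d * (d + n - 3))
  have i3 := (hint _ (hc.d2 (y0_smooth n).contDiffOn (y0_smooth n).contDiffOn)).const_mul ((‖y‖^2)⁻¹)
  simp only at i3
  rw [integral_sub i1 (i2.fun_add i3), integral_add i2 i3, integral_const_mul, integral_const_mul] at hS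
  unfold II
  linarith

lemma sum_tt (n : ℕ) (hn : 3 ≤ n) {f : En n → ℝ} (hf : ContDiffOn ℝ ∞ f {0}ᶜ) (d : ℝ)
    (he : ∀ x, x ≠ 0 → fderiv ℝ f x x = d * f x) (N : ℕ) (y : En n) (hy : y ≠ 0) (E : ℝ)
    (hE : II n (fun z => ∑ i, D2 (bb n f N) z (0, stdB n i) (0, stdB n i)) y = E) :
    ∑ i, II n (TT n (stdB n i) (TT n (stdB n i) (bb n f N))) y =
      E - (2 * N + 1) * (d - N) * (‖y‖^2)⁻¹ * II n (bb n f N) y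
        + ((‖y‖^2)⁻¹)^2 * II n (bb n f (N+2)) y := by
  have hb := bb_sm hf N
  have hint : ∀ c, Sm n c → Integrable (fun x => c (x, y)) ((μH[(n : ℝ) - 2]).restrict (Kset n y)) :=
    fun c h => h.int hn hy
  have h1 : ∑ i, II n (TT n (stdB n i) (TT n (stdB n i) (bb n f N))) y =
      ∫ x in Kset n y, ∑ i, TT n (stdB n i) (TT n (stdB n i) (bb n f N)) (x, y) ∂μH[(n : ℝ) - 2] := by
    rw [integral_finsetSum _ (fun i _ => hint _ ((hb.tt _).tt _))]; rfl
  have hpt : ∀ x ∈ Kset n y, ∑ i, TT n (stdB n i) (TT n (stdB n i) (bb n f N)) (x, y) =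
      ∑ i, D2 (bb n f N) (x, y) (0, stdB n i) (0, stdB n i)
      + (- ((2 * N + 1) * (d - N) * (‖y‖^2)⁻¹) * bb n f N (x, y)
        + ((‖y‖^2)⁻¹)^2 * bb n f (N+2) (x, y)) := by
    intro x hx
    have hz : (x, y) ∈ OO n := ⟨Kset_ne hx, hy⟩
    rw [alg2 n _ x y hz hb hx.2 hx.1]
    have e1 := bb_D2yy hf N hz
    have e2 := bb_euler hf d he N _ hz
    simp only at e1 e2
    have e3 : D2 (bb n f N) (x, y) (y, 0) (0, x) = N * (d - N) * bb n f N (x, y) := by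
      cases N with
      | zero => rw [bb_D2y_zero hf hz]; simp
      | succ N =>
        rw [bb_D2y hf N hz]
        have := bb_D2x hf N hz x
        simp only at this
        rw [this, e2]; push_cast; ring
    rw [e1, e2, e3]; ring
  rw [h1, setIntegral_congr_fun (Kset_compact n y).measurableSet hpt]
  have i1 : Integrable (fun x => ∑ i, D2 (bb n f N) (x, y) (0, stdB n i) (0, stdB n i))
      ((μH[(n : ℝ) - 2]).restrict (Kset n y)) :=
    integrable_finsetSum _ fun i _ => hint _ (hb.d2 contDiffOn_const contDiffOn_const)
  have i2 := (hint _ hb).const_mul (-((2 * N + 1) * (d - N) * (‖y‖^2)⁻¹))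
  have i3 := (hint _ (bb_sm hf (N+2))).const_mul (((‖y‖^2)⁻¹)^2)
  rw [integral_add i1 (i2.fun_add i3), integral_add i2 i3, integral_const_mul, integral_const_mul, ← hE]
  unfold II
  ring

lemma E_zero (n : ℕ) {f : En n → ℝ} (hf : ContDiffOn ℝ ∞ f {0}ᶜ) (y : En n) (hy : y ≠ 0) :
    II n (fun z => ∑ i, D2 (bb n f 0) z (0, stdB n i) (0, stdB n i)) y = 0 := by
  unfold II
  rw [setIntegral_congr_fun (g := fun _ => (0:ℝ)) (Kset_compact n y).measurableSet]
  · simp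
  · intro x hx
    have hz : (x, y) ∈ OO n := ⟨Kset_ne hx, hy⟩
    exact Finset.sum_eq_zero fun i _ => bb_D2y_zero hf hz _ _

lemma E_succ (n : ℕ) (hn : 3 ≤ n) {f : En n → ℝ} (hf : ContDiffOn ℝ ∞ f {0}ᶜ) (d : ℝ)
    (he : ∀ x, x ≠ 0 → fderiv ℝ f x x = d * f x) (N : ℕ) (y : En n) (hy : y ≠ 0) :
    II n (fun z => ∑ i, D2 (bb n f (N+2)) z (0, stdB n i) (0, stdB n i)) y =
      (N + 2) * (N + 1) * ((d - N) * (d - N + n - 3) * II n (bb n f N) y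
        + (‖y‖^2)⁻¹ * II n (bb n f (N+2)) y) := by
  have hb := bb_sm hf N
  have h := partC n hn _ hb (d - N) (bb_euler hf d he N) y hy
  have h2 : II n (fun z => D2 (bb n f N) z (z.2, 0) (z.2, 0)) y = II n (bb n f (N+2)) y :=
    setIntegral_congr_fun (Kset_compact n y).measurableSet fun x hx =>
      bb_D2yy hf N (z := (x, y)) ⟨Kset_ne hx, hy⟩
  rw [h2] at h
  rw [← h]
  unfold II
  rw [← integral_const_mul]
  refine setIntegral_congr_fun (Kset_compact n y).measurableSet fun x hx => ?_
  have hz : (x, y) ∈ OO n := ⟨Kset_ne hx, hy⟩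
  simp only [Finset.mul_sum]
  refine Finset.sum_congr rfl fun i _ => ?_
  rw [bb_D2y hf (N+1) hz, D2_symm (bb_sm hf (N+1)) hz, bb_D2y hf N hz]
  push_cast; ring

def rho (n : ℕ) (q : ℝ) (y : En n) : ℝ := (‖y‖^2) ^ q

lemma rho_deriv (n : ℕ) (q : ℝ) (y : En n) (hy : y ≠ 0) :
    ∃ L : En n →L[ℝ] ℝ, HasFDerivAt (rho n q) L y ∧ ∀ w, L w = 2 * q * ⟪y, w⟫ * rho n (q - 1) y := by
  have hr := norm_pos_iff.2 hy
  have h := ((hasFDerivAt_id (𝕜 := ℝ) y).norm_sq).rpow_const (p := q) (Or.inl (by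
    simp only [id]; positivity))
  refine ⟨_, h, fun w => ?_⟩
  simp [rho]; ring

lemma rho_succ (n : ℕ) (q : ℝ) (y : En n) (hy : y ≠ 0) :
    rho n q y = ‖y‖^2 * rho n (q - 1) y := by
  have hr := norm_pos_iff.2 hy
  unfold rho
  rw [Real.rpow_sub_one (by positivity)]
  field_simp

lemma rho_pow (n p : ℕ) (y : En n) (hy : y ≠ 0) : (‖y‖^p)⁻¹ = rho n (-(p : ℝ)/2) y := by
  have hr := norm_pos_iff.2 hy
  unfold rho
  rw [← Real.rpow_natCast ‖y‖ 2, ← Real.rpow_mul hr.le, ← Real.rpow_natCast, ← Real.rpow_neg hr.le]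
  congr 1; push_cast; ring

lemma J_eq (n : ℕ) (Q : En n → ℝ) (hf : ContDiffOn ℝ ∞ (fun z => 1 / Q z) {0}ᶜ) (k j : ℕ)
    (hk : 1 ≤ k) (y : En n) (hy : y ≠ 0) :
    Jfun n Q k j y = rho n (-(2 * (k : ℝ) - 1 + 2 * j) / 2) y *
      II n (bb n (fun z => 1 / Q z) (2 * j)) y := by
  have hr := norm_pos_iff.2 hy
  have h1 : ∀ x ∈ Kset n y, iteratedFDeriv ℝ (2*j) (fun z => 1 / Q z) x (fun _ => ‖y‖⁻¹ • y) =
      (‖y‖^(2*j))⁻¹ * bb n (fun z => 1 / Q z) (2 * j) (x, y) := by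
    intro x hx
    rw [ContinuousMultilinearMap.map_smul_univ, bb_iter hf (2*j) x y (Kset_ne hx) hy]
    simp
  have h2 : ∫ x in Kset n y, iteratedFDeriv ℝ (2*j) (fun z => 1 / Q z) x (fun _ => ‖y‖⁻¹ • y)
      ∂μH[(n : ℝ) - 2] = (‖y‖^(2*j))⁻¹ * II n (bb n (fun z => 1 / Q z) (2 * j)) y := by
    rw [setIntegral_congr_fun (Kset_compact n y).measurableSet h1, integral_const_mul]; rfl
  have h3 : Jfun n Q k j y = (1/‖y‖^(2*k - 1)) *
    ∫ x in Kset n y, iteratedFDeriv ℝ (2*j) (fun z => 1 / Q z) x (fun _ => ‖y‖⁻¹ • y)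
      ∂μH[(n : ℝ) - 2] := rfl
  have h4 : -(2 * (k : ℝ) - 1 + 2 * j) / 2 = -((2*k-1+2*j : ℕ) : ℝ)/2 := by
    push_cast [Nat.cast_sub (show 1 ≤ 2*k by omega)]; ring
  rw [h3, h2, h4, ← rho_pow n _ y hy, pow_add]
  field_simp

lemma lap_prod (n : ℕ) (hn : 3 ≤ n) (F : En n → ℝ) (q : ℝ) (b : En n × En n → ℝ) (hb : Sm n b)
    (M : ℝ) (hM : ∀ z ∈ OO n, fderiv ℝ b z (0, z.2) = M * b z)
    (hF : ∀ y, y ≠ 0 → F y = rho n q y * II n b y) (y : En n) (hy : y ≠ 0) :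
    lap n F y = (2 * q * n + 4 * q * (q - 1) + 4 * q * M) * rho n (q - 1) y * II n b y +
      rho n q y * ∑ i, II n (TT n (stdB n i) (TT n (stdB n i) b)) y := by
  have hr := norm_pos_iff.2 hy
  let g : En n → En n → ℝ := fun w y => 2 * q * ⟪y, w⟫ * rho n (q - 1) y * II n b y +
    rho n q y * II n (TT n w b) y
  have hg : ∀ y', y' ≠ 0 → ∀ w, fderiv ℝ F y' w = g w y' := by
    intro y' hy' w
    have e : F =ᶠ[𝓝 y'] fun y => rho n q y * II n b y := by
      filter_upwards [eventually_ne_nhds hy'] with u hu using hF u hu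
    obtain ⟨L, hL, hLw⟩ := rho_deriv n q y' hy'
    rw [e.fderiv_eq, (hL.fun_mul (II_diff n hn b hb y' hy').hasFDerivAt).fderiv]
    simp only [add_apply, smul_apply, smul_eq_mul, II_fderiv n hn b hb y' hy', hLw, g]
    ring
  have hgd : ∀ w, ∃ L : En n →L[ℝ] ℝ, HasFDerivAt (g w) L y ∧ L w =
      ⟪w, w⟫ * (2 * q * rho n (q - 1) y * II n b y)
      + ⟪y, w⟫ * ⟪y, w⟫ * (4 * q * (q - 1) * rho n (q - 1 - 1) y * II n b y)
      + 4 * q * rho n (q - 1) y * (⟪y, w⟫ * II n (TT n w b) y)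
      + rho n q y * II n (TT n w (TT n w b)) y := by
    intro w
    obtain ⟨L, hL, hLw⟩ := rho_deriv n q y hy
    obtain ⟨L1, hL1, hL1w⟩ := rho_deriv n (q - 1) y hy
    have hi : HasFDerivAt (fun y : En n => ⟪y, w⟫) _ y :=
      (hasFDerivAt_id (𝕜 := ℝ) y).inner ℝ (hasFDerivAt_const w y)
    have h := (((hi.const_mul (2 * q)).mul hL1).mul (II_diff n hn b hb y hy).hasFDerivAt).add
      (hL.mul (II_diff n hn _ (hb.tt w) y hy).hasFDerivAt)
    refine ⟨_, h, ?_⟩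
    simp only [add_apply, smul_apply, smul_eq_mul, II_fderiv n hn b hb y hy,
      II_fderiv n hn _ (hb.tt w) y hy, hLw, hL1w]
    simp [fderivInnerCLM_apply]
    ring
  obtain ⟨-, hs⟩ := snd_fd n F g y hy hg (fun w => by
    obtain ⟨L, hL, -⟩ := hgd w; exact hL.differentiableAt)
  have hT : ∑ i, y i * II n (TT n (stdB n i) b) y = M * II n b y := by
    have : ∀ i, y i * II n (TT n (stdB n i) b) y = fderiv ℝ (II n b) y (y i • stdB n i) := by
      intro i; rw [map_smul, II_fderiv n hn b hb y hy, smul_eq_mul]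
    simp only [this, ← map_sum, sum_stdB]
    rw [II_fderiv n hn b hb y hy]
    unfold II
    rw [← integral_const_mul]
    refine setIntegral_congr_fun (Kset_compact n y).measurableSet fun x hx => ?_
    have := hM (x, y) ⟨Kset_ne hx, hy⟩
    have hx2 : ⟪x, y⟫ = 0 := by rw [real_inner_comm]; exact hx.2
    simp only [TT, xi, hx2]
    simpa using this
  have hterm : ∀ i, iteratedFDeriv ℝ 2 F y (fun _ => stdB n i) =
      (2 * q * rho n (q - 1) y * II n b y)
      + y i * y i * (4 * q * (q - 1) * rho n (q - 1 - 1) y * II n b y)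
      + 4 * q * rho n (q - 1) y * (y i * II n (TT n (stdB n i) b) y)
      + rho n q y * II n (TT n (stdB n i) (TT n (stdB n i) b)) y := by
    intro i
    obtain ⟨L, hL, hLw⟩ := hgd (stdB n i)
    rw [iteratedFDeriv_two_apply, hs, hL.fderiv, hLw]
    have : ⟪stdB n i, stdB n i⟫ = 1 := by rw [inner_stdB]; simp [stdB]
    rw [this, inner_stdB, one_mul]
  unfold lap
  simp only [hterm, Finset.sum_add_distrib, ← Finset.mul_sum, ← Finset.sum_mul, hT]
  rw [sum_coord, real_inner_self_eq_norm_sq, rho_succ n (q-1) y hy]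
  simp
  ring

lemma Q_smooth (n : ℕ) (Q : En n → ℝ) (hQpoly : ∃ P : MvPolynomial (Fin n) ℝ,
      ∀ ξ : En n, Q ξ = MvPolynomial.eval (fun i => ξ i) P) : ContDiff ℝ ∞ Q := by
  obtain ⟨P, hP⟩ := hQpoly
  obtain rfl : Q = fun ξ => MvPolynomial.eval (fun i => ξ i) P := funext hP
  clear hP
  induction P using MvPolynomial.induction_on with
  | C a => simpa using contDiff_const
  | add p q hp hq => simpa using hp.add hq
  | mul_X p i hp =>
    have : ContDiff ℝ ∞ (fun ξ : En n => ξ i) := (EuclideanSpace.proj i : En n →L[ℝ] ℝ).contDiff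
    simpa using hp.mul this

lemma f_euler (n m : ℕ) (Q : En n → ℝ)
    (hf : ContDiffOn ℝ ∞ (fun z => 1 / Q z) {0}ᶜ)
    (hQhom : ∀ σ : ℝ, ∀ ξ : En n, Q (σ • ξ) = σ^(2*m) * Q ξ) (x : En n) (hx : x ≠ 0) :
    fderiv ℝ (fun z => 1 / Q z) x x = (-(2 * (m : ℝ))) * (1 / Q x) := by
  have hd : DifferentiableAt ℝ (fun z => 1 / Q z) x :=
    (hf.contDiffAt (isOpen_compl_singleton.mem_nhds hx)).differentiableAt (by simp)
  have h1 : HasDerivAt (fun s : ℝ => s • x) ((1 : ℝ) • x) 1 := (hasDerivAt_id (1:ℝ)).smul_const x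
  have h2 := HasFDerivAt.comp_hasDerivAt_of_eq (1 : ℝ) hd.hasFDerivAt h1 (by simp)
  have h3 : HasDerivAt (fun s : ℝ => (s ^ (2*m))⁻¹ * (1 / Q x)) (-(2 * (m : ℝ)) * (1 / Q x)) 1 := by
    have := ((hasDerivAt_pow (2*m) (1:ℝ)).fun_inv (by simp)).mul_const (1 / Q x)
    simpa using this
  have h4 : ((fun z => 1 / Q z) ∘ fun s : ℝ => s • x) = (fun s : ℝ => (s ^ (2*m))⁻¹ * (1 / Q x)) := by
    funext s
    simp [hQhom, mul_comm]
  rw [h4] at h2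
  have := h2.unique h3
  simpa using this

/-- The recursion Δ J_{k,j} = c_Δ J_{k+1,j−1} + c₀ J_{k+1,j} + J_{k+1,j+1}. -/
theorem stmt11 (n m : ℕ) (hn : 3 ≤ n) (hm : 1 ≤ m)
    (Q : En n → ℝ)
    (hQpoly : ∃ P : MvPolynomial (Fin n) ℝ,
      ∀ ξ : En n, Q ξ = MvPolynomial.eval (fun i => ξ i) P)
    (hQhom : ∀ σ : ℝ, ∀ ξ : En n, Q (σ • ξ) = σ^(2*m) * Q ξ)
    (hQpos : ∀ ξ : En n, ξ ≠ 0 → 0 < Q ξ)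
    (k j : ℕ) (hk : 1 ≤ k) :
    ∀ y : En n, y ≠ 0 →
      (1 ≤ j →
        lap n (Jfun n Q k j) y =
          (4*(j : ℝ) * (2*(j : ℝ) - 1) * ((m : ℝ) + j - 1) * (2*(m : ℝ) + 2*j + 1 - n)) *
              Jfun n Q (k+1) (j-1) y
            + (2*(k : ℝ)*(2*(k : ℝ) - 1) + ((n : ℝ) - 1)*(1 - 2*(k : ℝ) - 2*j)
                + 2*(4*(j : ℝ) + 1)*((m : ℝ) + j)) * Jfun n Q (k+1) j y
            + Jfun n Q (k+1) (j+1) y) ∧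
      (j = 0 →
        lap n (Jfun n Q k 0) y =
          (2*(k : ℝ)*(2*(k : ℝ) - 1) + ((n : ℝ) - 1)*(1 - 2*(k : ℝ)) + 2*(m : ℝ)) *
              Jfun n Q (k+1) 0 y
            + Jfun n Q (k+1) 1 y) := by
  intro y hy
  have hf : ContDiffOn ℝ ∞ (fun z => 1 / Q z) {0}ᶜ :=
    ContDiffOn.div contDiffOn_const (Q_smooth n Q hQpoly).contDiffOn
      (fun x hx => (hQpos x hx).ne')
  have he := f_euler n m Q hf hQhom
  have hr := norm_pos_iff.2 hy
  have hJ := fun k' j' hk' => J_eq n Q hf k' j' hk' y hy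
  have hL := fun j => lap_prod n hn (Jfun n Q k j) (-(2 * (k : ℝ) - 1 + 2 * j) / 2)
    (bb n (fun z => 1 / Q z) (2 * j)) (bb_sm hf _) _ (fun z hz => bb_yeuler hf (2 * j) hz)
    (fun y' hy' => J_eq n Q hf k j hk y' hy') y hy
  constructor
  · intro hj
    obtain ⟨i, rfl⟩ : ∃ i, j = i + 1 := ⟨j - 1, by omega⟩
    rw [hL, show 2 * (i + 1) = 2 * i + 2 by ring,
      sum_tt n hn hf _ he _ y hy _ (E_succ n hn hf _ he (2 * i) y hy), hJ _ _ (by omega),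
      hJ _ _ (by omega), hJ _ _ (by omega), show 2 * (i + 1) = 2 * i + 2 by ring,
      show 2 * (i + 1 + 1) = 2 * i + 2 + 2 by ring, Nat.add_sub_cancel]
    push_cast
    set q : ℝ := -(2 * (k : ℝ) - 1 + 2 * (i + 1)) / 2 with hq
    rw [show -(2 * ((k : ℝ) + 1) - 1 + 2 * i) / 2 = q by rw [hq]; ring,
      show -(2 * ((k : ℝ) + 1) - 1 + 2 * (i + 1)) / 2 = q - 1 by rw [hq]; ring,
      show -(2 * ((k : ℝ) + 1) - 1 + 2 * (i + 1 + 1)) / 2 = q - 1 - 1 by rw [hq]; ring,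
      rho_succ n q y hy, rho_succ n (q - 1) y hy]
    have hk2 : (k : ℝ) = -q - i - 1 / 2 := by rw [hq]; ring
    rw [hk2]
    clear_value q
    field_simp
    ring
  · rintro rfl
    rw [hL, show 2 * 0 = 0 by ring, sum_tt n hn hf _ he _ y hy _ (E_zero n hf y hy),
      hJ _ _ (by omega), hJ _ _ (by omega), show 2 * 0 = 0 by ring, show 2 * 1 = 0 + 2 by ring]
    push_cast
    set q : ℝ := -(2 * (k : ℝ) - 1 + 2 * 0) / 2 with hq
    rw [show -(2 * ((k : ℝ) + 1) - 1 + 2 * 0) / 2 = q - 1 by rw [hq]; ring,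
      show -(2 * ((k : ℝ) + 1) - 1 + 2 * 1) / 2 = q - 1 - 1 by rw [hq]; ring,
      rho_succ n q y hy, rho_succ n (q - 1) y hy]
    have hk2 : (k : ℝ) = -q + 1 / 2 := by rw [hq]; ring
    rw [hk2]
    clear_value q
    field_simp
    ring
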